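/- arXiv:2409.19195 — 3 statements merged into one kernel-verified Lean document; each statement's English description precedes it below -/
import Mathlib

section
/- Let v be a binary word and p ∈ (0,1). Let Ω(v) denote the set of binary words u such that v is a suffix of u and v occurs exactly once as a subword of u. Then Σ_{u ∈ Ω(v)} len(u)·ℙ_p(u) = vv_p; that is, the expected time until v first occurs in an iid Bernoulli(p) bit sequence equals the auto-correlation polynomial vv_p. -/
open scoped BigOperators

/-- Bernoulli(p) weight of a binary word `u`: `ℙ_p(u) = p^{‖u‖₁} (1-p)^{‖u‖₀}`. -/
noncomputable def wProb (p : ℝ) (u : List Bool) : ℝ :=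
  p ^ (u.count true) * (1 - p) ^ (u.count false)

/-- Number of occurrences of `v` as a contiguous subword of `u`. -/
def occCount (v u : List Bool) : ℕ :=
  (List.range (u.length + 1)).countP (fun i => decide (v <+: u.drop i))

/-- `Ω_{v,w}(v)`: binary words having `v` as a suffix, containing `v` exactly once
as a subword, and not containing `w` as a subword.  (`Ω_{v,w}(w) = OmegaWin w v`.) -/
def OmegaWin (v w : List Bool) : Set (List Bool) :=
  {u | v <:+ u ∧ occCount v u = 1 ∧ ¬ (w <:+: u)}

/-- The win probability `Win(v,w;p) = ∑_{u ∈ Ω_{v,w}(v)} ℙ_p(u)`. -/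
noncomputable def Win (v w : List Bool) (p : ℝ) : ℝ :=
  ∑' u : OmegaWin v w, wProb p u

/-- The correlation polynomial `vw_p = ∑_{u ∈ O(v,w)} ℙ_p(u)⁻¹`, where `O(v,w)` is
the set of nonempty words that are simultaneously a suffix of `v` and a prefix of `w`. -/
noncomputable def corr (v w : List Bool) (p : ℝ) : ℝ :=
  ∑ i ∈ Finset.Icc 1 w.length,
    if w.take i <:+ v then (wProb p (w.take i))⁻¹ else 0

/-- `Ω*_{v,w}(v) = {x : x ++ v ∈ Ω_{v,w}(v)}` (with `x` possibly empty). -/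
def OmegaStarV (v w : List Bool) : Set (List Bool) :=
  {x | x ++ v ∈ OmegaWin v w}

/-- Property `R`: `Ω*_{v,w}(v) = Ω*_{v,w}(w)`. -/
def PropR (v w : List Bool) : Prop :=
  OmegaStarV v w = {x | x ++ w ∈ OmegaWin w v}

/-- `D(v,w)`: nonempty proper prefixes `v₁⋯v_{n-k}` of `v` (`1 ≤ k ≤ n-1`) such that
`w₁⋯w_k = v_{n-k+1}⋯v_n`. -/
def Dset (v w : List Bool) : Set (List Bool) :=
  {x | ∃ k, 1 ≤ k ∧ k ≤ v.length - 1 ∧ k ≤ w.length ∧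
    x = v.take (v.length - k) ∧ w.take k = v.drop (v.length - k)}

/-- `F(v,w) = D(v,v) ∪ D(w,w) ∪ D(w,v) ∪ D(v,w)`. -/
def Fset (v w : List Bool) : Set (List Bool) :=
  Dset v v ∪ Dset w w ∪ Dset w v ∪ Dset v w

/-- `a^m`: concatenation of `m` copies of the word `a`. -/
def wpow (a : List Bool) (m : ℕ) : List Bool :=
  (List.replicate m a).flatten

lemma wProb_append (p : ℝ) (x y : List Bool) : wProb p (x ++ y) = wProb p x * wProb p y := by
  simp only [wProb, List.count_append, pow_add]
  ring

lemma wProb_pos {p : ℝ} (hp : p ∈ Set.Ioo (0 : ℝ) 1) (u : List Bool) : 0 < wProb p u :=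
  mul_pos (pow_pos hp.1 _) (pow_pos (sub_pos.2 hp.2) _)

lemma occCount_cons (v : List Bool) (c : Bool) (u : List Bool) :
    occCount v (c :: u) = occCount v u + if v <+: c :: u then 1 else 0 := by
  unfold occCount
  rw [List.length_cons, List.range_succ_eq_map, List.countP_cons, List.countP_map]
  simp [Function.comp_def]

lemma occCount_nil {v : List Bool} (hv : v ≠ []) : occCount v [] = 0 := by
  simp [occCount, hv]

lemma occCount_concat {v : List Bool} (hv : v ≠ []) (y : List Bool) (b : Bool) :
    occCount v (y ++ [b]) = occCount v y + if v <:+ y ++ [b] then 1 else 0 := by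
  induction y with
  | nil =>
    rw [List.nil_append, occCount_cons]
    simp [occCount_nil hv, List.prefix_cons_iff, List.suffix_cons_iff, hv]
  | cons c y ih =>
    have h1 : v <+: c :: (y ++ [b]) ↔ v = c :: (y ++ [b]) ∨ v <+: c :: y := by
      rw [← List.cons_append, List.prefix_concat_iff]
    have h2 : v = c :: (y ++ [b]) → ¬ v <+: c :: y := fun h h' => by
      have := h'.length_le
      simp [h] at this
    have h3 : v = c :: (y ++ [b]) → ¬ v <:+ y ++ [b] := fun h h' => by
      have := h'.length_le
      simp [h] at this
    rw [List.cons_append, occCount_cons, ih, occCount_cons]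
    have h4 : v <:+ c :: (y ++ [b]) ↔ v = c :: (y ++ [b]) ∨ v <:+ y ++ [b] := List.suffix_cons_iff
    by_cases h : v = c :: (y ++ [b])
    · rw [if_neg (h3 h), if_pos (h1.2 (Or.inl h)), if_neg (h2 h), if_pos (h4.2 (Or.inl h))]
    · simp only [h1, h4, h, false_or]
      omega

lemma occCount_eq_zero_iff {v : List Bool} (hv : v ≠ []) (u : List Bool) :
    occCount v u = 0 ↔ ¬ v <:+: u := by
  induction u with
  | nil => simp [occCount_nil hv, hv]
  | cons c u ih => rw [occCount_cons, List.infix_cons_iff]; split_ifs <;> simp_all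

/-- Indicator of the words that do not contain `v`. -/
noncomputable def avoidInd (v u : List Bool) : ℝ :=
  open Classical in if v <:+: u then 0 else 1

/-- Indicator of the words in which `v` occurs exactly once, as a suffix. -/
noncomputable def firstInd (v u : List Bool) : ℝ :=
  Set.indicator {u : List Bool | v <:+ u ∧ occCount v u = 1} 1 u

lemma firstInd_nonneg (v u : List Bool) : 0 ≤ firstInd v u :=
  Set.indicator_nonneg (fun _ _ => zero_le_one) u

lemma avoidInd_nonneg (v u : List Bool) : 0 ≤ avoidInd v u := by
  unfold avoidInd
  split_ifs <;> norm_num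

lemma firstInd_eq_zero {v u : List Bool} (h : ¬ v <:+ u) : firstInd v u = 0 :=
  Set.indicator_of_notMem (fun hu => h hu.1) _

lemma firstInd_eq_zero_of_length_lt {v u : List Bool} (h : u.length < v.length) :
    firstInd v u = 0 :=
  firstInd_eq_zero fun hs => absurd hs.length_le (by omega)

lemma avoidInd_concat {v : List Bool} (hv : v ≠ []) (y : List Bool) (b : Bool) :
    avoidInd v y = avoidInd v (y ++ [b]) + firstInd v (y ++ [b]) := by
  unfold avoidInd firstInd
  simp only [Set.indicator_apply, Set.mem_ofPred_eq, Pi.one_apply]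
  have h := occCount_concat hv y b
  have h1 := occCount_eq_zero_iff hv y
  have h2 := List.infix_concat_iff (l₁ := v) (l₂ := y) (a := b)
  by_cases hy : v <:+: y <;> by_cases hs : v <:+ y ++ [b] <;> simp_all

/-- The finite set of binary words of length `k`. -/
noncomputable def wordsOfLength (k : ℕ) : Finset (List Bool) :=
  (List.finite_length_eq Bool k).toFinset

@[simp]
lemma mem_wordsOfLength {k : ℕ} {u : List Bool} : u ∈ wordsOfLength k ↔ u.length = k := by
  simp [wordsOfLength]

lemma sum_wordsOfLength_succ (G : List Bool → ℝ) (k : ℕ) :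
    ∑ u ∈ wordsOfLength (k + 1), G u =
      ∑ y ∈ wordsOfLength k, (G (y ++ [true]) + G (y ++ [false])) := by
  have : ∑ u ∈ wordsOfLength (k + 1), G u =
      ∑ z ∈ wordsOfLength k ×ˢ (Finset.univ : Finset Bool), G (z.1 ++ [z.2]) := by
    symm
    refine Finset.sum_bij (fun z _ => z.1 ++ [z.2]) ?_ ?_ ?_ (fun _ _ => rfl)
    · intro z hz
      simpa using hz
    · rintro ⟨z, b⟩ _ ⟨w, c⟩ _ h
      simpa using h
    · intro u hu
      rw [mem_wordsOfLength] at hu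
      have hne : u ≠ [] := by rintro rfl; simp at hu
      exact ⟨(u.dropLast, u.getLast hne), by simp [hu], List.dropLast_append_getLast hne⟩
  rw [this, Finset.sum_product]
  simp

/-- Probability that `k` random bits do not contain `v`. -/
noncomputable def avoidProb (v : List Bool) (p : ℝ) (k : ℕ) : ℝ :=
  ∑ u ∈ wordsOfLength k, avoidInd v u * wProb p u

/-- Probability that `v` first occurs at time `k`. -/
noncomputable def firstProb (v : List Bool) (p : ℝ) (k : ℕ) : ℝ :=
  ∑ u ∈ wordsOfLength k, firstInd v u * wProb p u

lemma avoidProb_nonneg {p : ℝ} (hp : p ∈ Set.Ioo (0 : ℝ) 1) (v : List Bool) (k : ℕ) :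
    0 ≤ avoidProb v p k :=
  Finset.sum_nonneg fun u _ => mul_nonneg (avoidInd_nonneg v u) (wProb_pos hp u).le

lemma firstProb_nonneg {p : ℝ} (hp : p ∈ Set.Ioo (0 : ℝ) 1) (v : List Bool) (k : ℕ) :
    0 ≤ firstProb v p k :=
  Finset.sum_nonneg fun u _ => mul_nonneg (firstInd_nonneg v u) (wProb_pos hp u).le

lemma firstProb_eq_zero (v : List Bool) (p : ℝ) {k : ℕ} (hk : k < v.length) :
    firstProb v p k = 0 :=
  Finset.sum_eq_zero fun u hu => by
    rw [firstInd_eq_zero_of_length_lt (by rwa [mem_wordsOfLength.1 hu]), zero_mul]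

lemma avoidProb_eq_add {v : List Bool} (hv : v ≠ []) (p : ℝ) (k : ℕ) :
    avoidProb v p k = avoidProb v p (k + 1) + firstProb v p (k + 1) := by
  unfold avoidProb firstProb
  rw [← Finset.sum_add_distrib, sum_wordsOfLength_succ]
  refine Finset.sum_congr rfl fun y _ => ?_
  simp only [← add_mul, ← avoidInd_concat hv, wProb_append]
  simp [wProb]
  ring

lemma avoidProb_zero {v : List Bool} (hv : v ≠ []) (p : ℝ) : avoidProb v p 0 = 1 := by
  have : wordsOfLength 0 = {[]} := by ext u; simp
  simp [avoidProb, this, avoidInd, wProb, hv]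

lemma avoidProb_eq_one {v : List Bool} (hv : v ≠ []) (p : ℝ) {k : ℕ} (hk : k < v.length) :
    avoidProb v p k = 1 := by
  induction k with
  | zero => exact avoidProb_zero hv p
  | succ k ih => linarith [ih (by omega), avoidProb_eq_add hv p k, firstProb_eq_zero v p hk]

lemma sum_firstProb {v : List Bool} (hv : v ≠ []) (p : ℝ) (j N : ℕ) :
    ∑ k ∈ Finset.range N, firstProb v p (k + (j + 1)) =
      avoidProb v p j - avoidProb v p (N + j) := by
  induction N with
  | zero => simp
  | succ N ih =>
    rw [Finset.sum_range_succ, ih, show N + 1 + j = N + j + 1 by ring,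
      avoidProb_eq_add hv p (N + j), ← add_assoc]
    ring

/-- The first occurrence of `v` in `x ++ v` ends within the final copy of `v`. -/
lemma avoidInd_eq_sum {v : List Bool} (hv : v ≠ []) (x : List Bool) :
    avoidInd v x = ∑ i ∈ Finset.Icc 1 v.length, firstInd v (x ++ v.take i) := by
  have step : ∀ m ≤ v.length, avoidInd v x =
      avoidInd v (x ++ v.take m) + ∑ i ∈ Finset.Icc 1 m, firstInd v (x ++ v.take i) := by
    intro m
    induction m with
    | zero => simp
    | succ m ih =>
      intro hm
      rw [ih (by omega), Finset.sum_Icc_succ_top (by omega), List.take_succ_eq_append_getElem hm,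
        ← List.append_assoc, avoidInd_concat hv (x ++ v.take m) v[m]]
      ring
  have h := step v.length le_rfl
  have h0 : avoidInd v (x ++ v.take v.length) = 0 := by
    rw [List.take_length]
    exact if_pos (List.suffix_append x v).isInfix
  rwa [h0, zero_add] at h

lemma sum_firstInd_append_take (v : List Bool) (p : ℝ) (k : ℕ) {i : ℕ} (hi : i ≤ v.length) :
    ∑ x ∈ wordsOfLength k, firstInd v (x ++ v.take i) * wProb p (x ++ v.take i) =
      if v.take i <:+ v then firstProb v p (k + i) else 0 := by
  split_ifs with h
  · unfold firstProb
    refine Finset.sum_bij_ne_zero (fun x _ _ => x ++ v.take i) ?_ ?_ ?_ (fun _ _ _ => rfl)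
    · intro x hx _
      simp_all
    · intro x _ _ y _ _ hxy
      simpa using hxy
    · intro u hu hne
      have hs : v <:+ u := by
        by_contra hs
        exact hne (by rw [firstInd_eq_zero hs, zero_mul])
      obtain ⟨x, rfl⟩ := h.trans hs
      refine ⟨x, ?_, hne, rfl⟩
      simpa [hi] using hu
  · refine Finset.sum_eq_zero fun x _ => ?_
    rw [firstInd_eq_zero, zero_mul]
    exact fun hs => h (List.suffix_of_suffix_length_le (List.suffix_append _ _) hs (by simp))

lemma avoidProb_eq_sum {v : List Bool} (hv : v ≠ []) {p : ℝ} (hp : p ∈ Set.Ioo (0 : ℝ) 1)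
    (k : ℕ) :
    avoidProb v p k = ∑ i ∈ Finset.Icc 1 v.length,
      (if v.take i <:+ v then (wProb p (v.take i))⁻¹ else 0) * firstProb v p (k + i) := by
  unfold avoidProb
  simp_rw [avoidInd_eq_sum hv, Finset.sum_mul]
  rw [Finset.sum_comm]
  refine Finset.sum_congr rfl fun i hi => ?_
  have h := sum_firstInd_append_take v p k (Finset.mem_Icc.1 hi).2
  have hne := (wProb_pos hp (v.take i)).ne'
  simp only [wProb_append, ← mul_assoc] at h
  rw [← Finset.sum_mul] at h
  rw [eq_div_of_mul_eq hne h]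
  split_ifs <;> ring

open Filter Topology in
/-- Expectation as the sum of tail probabilities. -/
lemma hasSum_nat_mul_of_tail {a f : ℕ → ℝ} {s : ℝ} (ha : ∀ k, 0 ≤ a k) (hf : ∀ k, 0 ≤ f k)
    (h : ∀ k, a k = a (k + 1) + f (k + 1)) (hs : HasSum a s) :
    HasSum (fun k : ℕ => (k : ℝ) * f k) s := by
  rw [← hasSum_nat_add_iff' 1]
  simp only [Finset.sum_range_one, Nat.cast_zero, zero_mul, sub_zero]
  set T : ℕ → ℝ := fun N => ∑ k ∈ Finset.range N, ((k + 1 : ℕ) : ℝ) * f (k + 1)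
  set S : ℕ → ℝ := fun N => ∑ k ∈ Finset.range N, a k
  have hT : ∀ N, T (N + 1) = T N + ((N : ℝ) + 1) * f (N + 1) := fun N => by
    simp [T, Finset.sum_range_succ]
  have hTS : ∀ N : ℕ, T N = S N - N * a N := by
    intro N
    induction N with
    | zero => simp [T, S]
    | succ N ih =>
      have : S (N + 1) = S N + a N := Finset.sum_range_succ _ _
      rw [hT, ih, this, Nat.cast_succ, h N]
      ring
  have hle : ∀ N, T N ≤ s := fun N => by
    have h1 : S N ≤ s := sum_le_hasSum _ (fun k _ => ha k) hs
    have h2 := mul_nonneg (Nat.cast_nonneg (α := ℝ) N) (ha N)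
    linarith [hTS N]
  have hnn : ∀ k : ℕ, 0 ≤ ((k + 1 : ℕ) : ℝ) * f (k + 1) := fun k =>
    mul_nonneg (Nat.cast_nonneg _) (hf _)
  obtain ⟨t, ht⟩ := summable_of_sum_range_le hnn hle
  have hST : ∀ N M : ℕ, N ≤ M → S N - N * a M ≤ T M := by
    intro N M hNM
    induction M, hNM using Nat.le_induction with
    | base => exact (hTS N).ge
    | succ M hNM ih =>
      have h1 : (N : ℝ) ≤ M := Nat.cast_le.2 hNM
      rw [hT]
      nlinarith [h M, hf (M + 1)]
  have hSt : ∀ N, S N ≤ t := fun N => by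
    have h1 : Tendsto (fun M => S N - N * a M) atTop (𝓝 (S N)) := by
      simpa using (hs.summable.tendsto_atTop_zero.const_mul (N : ℝ)).const_sub (S N)
    exact le_of_tendsto_of_tendsto h1 ht.tendsto_sum_nat
      ((eventually_ge_atTop N).mono fun M hM => hST N M hM)
  have : t = s := le_antisymm (le_of_tendsto' ht.tendsto_sum_nat hle)
    (le_of_tendsto' hs.tendsto_sum_nat hSt)
  rwa [← this]

lemma summable_avoidProb {v : List Bool} (hv : v ≠ []) {p : ℝ} (hp : p ∈ Set.Ioo (0 : ℝ) 1) :
    Summable (avoidProb v p) := by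
  refine summable_of_sum_range_le (c := corr v v p) (avoidProb_nonneg hp v) fun N => ?_
  simp_rw [avoidProb_eq_sum hv hp]
  rw [Finset.sum_comm]
  refine Finset.sum_le_sum fun i hi => ?_
  rw [← Finset.mul_sum]
  refine mul_le_of_le_one_right ?_ ?_
  · split_ifs
    · exact (inv_pos.2 (wProb_pos hp _)).le
    · exact le_rfl
  · obtain ⟨hi1, hi2⟩ := Finset.mem_Icc.1 hi
    obtain ⟨j, rfl⟩ := Nat.exists_eq_add_of_le' hi1
    rw [sum_firstProb hv, avoidProb_eq_one hv p (by omega)]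
    linarith [avoidProb_nonneg hp v (N + j)]

lemma hasSum_avoidProb {v : List Bool} (hv : v ≠ []) {p : ℝ} (hp : p ∈ Set.Ioo (0 : ℝ) 1) :
    HasSum (avoidProb v p) (corr v v p) := by
  have key : ∀ i ∈ Finset.Icc 1 v.length, HasSum (fun k => firstProb v p (k + i)) 1 := by
    intro i hi
    obtain ⟨hi1, hi2⟩ := Finset.mem_Icc.1 hi
    obtain ⟨j, rfl⟩ := Nat.exists_eq_add_of_le' hi1
    rw [hasSum_iff_tendsto_nat_of_nonneg fun k => firstProb_nonneg hp v _]
    simp_rw [sum_firstProb hv, avoidProb_eq_one hv p (show j < v.length by omega)]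
    have h := (Filter.tendsto_add_atTop_iff_nat j).2
      (summable_avoidProb hv hp).tendsto_atTop_zero
    simpa using h.const_sub 1
  have h := hasSum_sum fun i hi => (key i hi).mul_left
    (if v.take i <:+ v then (wProb p (v.take i))⁻¹ else 0)
  simp only [mul_one] at h
  rwa [funext (avoidProb_eq_sum hv hp)]

/-- A nonnegative family on binary words may be summed length by length. -/
lemma hasSum_of_hasSum_wordsOfLength {G : List Bool → ℝ} {s : ℝ} (hG : ∀ u, 0 ≤ G u)
    (h : HasSum (fun k => ∑ u ∈ wordsOfLength k, G u) s) : HasSum G s := by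
  let e := Equiv.sigmaFiberEquiv (List.length : List Bool → ℕ)
  have hfib : ∀ k, HasSum (fun u : {u : List Bool // u.length = k} => G u)
      (∑ u ∈ wordsOfLength k, G u) := fun k => by
    have hset : ((wordsOfLength k : Finset (List Bool)) : Set (List Bool)) =
        {u | u.length = k} := by ext; simp
    have h1 := hasSum_subtype_iff_indicator.1 (Finset.hasSum (wordsOfLength k) G)
    rw [hset] at h1
    exact hasSum_subtype_iff_indicator.2 h1
  rw [← e.hasSum_iff]
  refine HasSum.sigma_of_hasSum h hfib ?_
  refine (summable_sigma_of_nonneg fun z => hG (e z)).2 ⟨fun k => (hfib k).summable, ?_⟩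
  convert! h.summable using 1
  exact funext fun k => (hfib k).tsum_eq

/-- The expected hitting time of `v` equals the auto-correlation polynomial `vv_p`. -/
theorem stmt1 (v : List Bool) (hv : v ≠ []) (p : ℝ) (hp : p ∈ Set.Ioo (0:ℝ) 1) :
    ∑' u : {u : List Bool | v <:+ u ∧ occCount v u = 1},
        ((u : List Bool).length : ℝ) * wProb p u = corr v v p := by
  have h := hasSum_nat_mul_of_tail (avoidProb_nonneg hp v) (firstProb_nonneg hp v)
    (avoidProb_eq_add hv p) (hasSum_avoidProb hv hp)
  have hG : HasSum (fun u : List Bool => firstInd v u * ((u.length : ℝ) * wProb p u))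
      (corr v v p) := by
    refine hasSum_of_hasSum_wordsOfLength (fun u => mul_nonneg (firstInd_nonneg v u)
      (mul_nonneg (Nat.cast_nonneg _) (wProb_pos hp u).le)) ?_
    convert h using 2 with k
    rw [firstProb, Finset.mul_sum]
    refine Finset.sum_congr rfl fun u hu => ?_
    rw [mem_wordsOfLength.1 hu]
    ring
  refine HasSum.tsum_eq ((hasSum_subtype_iff_indicator
    (f := fun u : List Bool => (u.length : ℝ) * wProb p u)).2 ?_)
  convert hG using 2 with u
  simp [firstInd, Set.indicator_apply]
end

section
/- For each integer m ≥ 1, let v = 11(10)^m (the word 11 followed by m copies of 10) and w = (10)^m 1 (m copies of 10 followed by 1). Then there is a constant C > 0, independent of m, such that for all m ≥ 1: 1/2 − C·4^{−m} ≤ Win(v,w;1/2) < 1/2. -/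
open scoped BigOperators

open MeasureTheory
open scoped ENNReal

instance : MeasurableSpace (List Bool) := ⊤

/-- The measure on binary words giving each word `u` the mass `2 ^ (-|u|)`. -/
noncomputable def wordMeasure : Measure (List Bool) :=
  Measure.sum fun u => (2⁻¹ : ℝ≥0∞) ^ u.length • Measure.dirac u

/-- The words in which no pattern of `P` occurs. -/
def avoid (P : Finset (List Bool)) : Set (List Bool) :=
  {u | ∀ y ∈ P, ¬ y <:+: u}

/-- The words whose first occurrence of a pattern of `P` is a terminal occurrence of `y`. -/
def hit (P : Finset (List Bool)) (y : List Bool) : Set (List Bool) :=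
  {u | y <:+ u ∧ u.dropLast ∈ avoid P}

theorem wordMeasure_apply (S : Set (List Bool)) :
    wordMeasure S = ∑' u : S, (2⁻¹ : ℝ≥0∞) ^ (u : List Bool).length := by
  rw [wordMeasure, Measure.sum_apply _ .of_discrete,
    tsum_subtype S (fun u => (2⁻¹ : ℝ≥0∞) ^ u.length)]
  refine tsum_congr fun u => ?_
  by_cases h : u ∈ S <;> simp [h]

theorem wordMeasure_singleton_nil : wordMeasure {[]} = 1 := by
  rw [wordMeasure_apply]
  simp

theorem wordMeasure_image_append (S : Set (List Bool)) (z : List Bool) :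
    wordMeasure ((· ++ z) '' S) = wordMeasure S * 2⁻¹ ^ z.length := by
  rw [wordMeasure_apply, wordMeasure_apply,
    tsum_image (fun u => (2⁻¹ : ℝ≥0∞) ^ u.length) (List.append_left_injective z).injOn,
    ← ENNReal.tsum_mul_right]
  simp [pow_add]

theorem wordMeasure_dropLast_mem (S : Set (List Bool)) :
    wordMeasure {u | u ≠ [] ∧ u.dropLast ∈ S} = wordMeasure S := by
  have h : {u : List Bool | u ≠ [] ∧ u.dropLast ∈ S} =
      (· ++ [true]) '' S ∪ (· ++ [false]) '' S := by
    ext u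
    rcases List.eq_nil_or_concat u with rfl | ⟨x, b, rfl⟩
    · simp
    · cases b <;> simp
  rw [h, measure_union _ .of_discrete, wordMeasure_image_append, wordMeasure_image_append,
    ← mul_add]
  · simp [ENNReal.inv_two_add_inv_two]
  · rw [Set.disjoint_left]
    rintro _ ⟨x, -, rfl⟩ ⟨y, -, h⟩
    simp at h

theorem wordMeasure_length_lt_ne_top (n : ℕ) :
    wordMeasure {u | u.length < n} ≠ ∞ := by
  have := (List.finite_length_lt Bool n).to_subtype
  have := Fintype.ofFinite {u : List Bool | u.length < n}
  rw [wordMeasure_apply, tsum_fintype]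
  exact ENNReal.sum_ne_top.2 fun u _ => by finiteness

section Patterns

variable {P : Finset (List Bool)}

theorem avoid_of_infix {x u : List Bool} (hu : u ∈ avoid P) (h : x <:+: u) : x ∈ avoid P :=
  fun y hy hyx => hu y hy (hyx.trans h)

theorem nil_mem_avoid (hne : ∀ y ∈ P, y ≠ []) : [] ∈ avoid P :=
  fun y hy h => hne y hy (List.infix_nil.1 h)

theorem ne_nil_of_mem_hit {y u : List Bool} (hy : y ≠ []) (hu : u ∈ hit P y) : u ≠ [] := by
  rintro rfl
  exact hy (List.suffix_nil.1 hu.1)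

/-- Words with an avoiding `dropLast` either avoid or have just been hit. -/
theorem mem_avoid_or_mem_hit {u : List Bool} (hu : u.dropLast ∈ avoid P) :
    u ∈ avoid P ∨ ∃ y ∈ P, u ∈ hit P y := by
  by_contra! h
  apply h.1
  intro y hy hyu
  rcases List.eq_nil_or_concat u with rfl | ⟨x, b, rfl⟩
  · exact hu y hy hyu
  · rw [List.concat_eq_append] at *
    rcases List.infix_concat_iff.1 hyu with h' | h'
    · exact h.2 y hy ⟨h', hu⟩
    · exact hu y hy (by simpa using h')

theorem eq_of_prefix_of_mem_hit {y y' u u' z : List Bool} (hy : y ∈ P) (hy' : y' ∈ P)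
    (hu : u ∈ hit P y) (hu' : u' ∈ hit P y') (h : u <+: z) (h' : u' <+: z) : u = u' := by
  wlog hl : u.length ≤ u'.length generalizing y y' u u'
  · exact (this hy' hy hu' hu h' h (by omega)).symm
  by_contra hne
  have hp : u <+: u' := List.prefix_of_prefix_length_le h h' hl
  obtain ⟨t, rfl⟩ := hp
  have ht : t ≠ [] := by rintro rfl; simp at hne
  refine hu'.2 y hy (hu.1.isInfix.trans ?_)
  rw [List.dropLast_append_of_ne_nil ht]
  exact (List.prefix_append _ _).isInfix

theorem disjoint_avoid_hit {y : List Bool} (hy : y ∈ P) : Disjoint (avoid P) (hit P y) :=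
  Set.disjoint_left.2 fun _ h h' => h y hy h'.1.isInfix

theorem eq_of_mem_hit (hP : ∀ y ∈ P, ∀ z ∈ P, y <:+: z → y = z) {y y' u : List Bool}
    (hy : y ∈ P) (hy' : y' ∈ P) (hu : u ∈ hit P y) (hu' : u ∈ hit P y') : y = y' := by
  rcases List.suffix_or_suffix_of_suffix hu.1 hu'.1 with h | h
  · exact hP _ hy _ hy' h.isInfix
  · exact (hP _ hy' _ hy h.isInfix).symm

theorem setOf_dropLast_mem_avoid (hne : ∀ y ∈ P, y ≠ []) :
    {u | u ≠ [] ∧ u.dropLast ∈ avoid P} = avoid P \ {[]} ∪ ⋃ y ∈ P, hit P y := by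
  ext u
  simp only [Set.mem_ofPred_eq, Set.mem_union, Set.mem_sdiff, Set.mem_singleton_iff, Set.mem_iUnion,
    exists_prop]
  constructor
  · rintro ⟨h0, hu⟩
    exact (mem_avoid_or_mem_hit hu).imp (fun h => ⟨h, h0⟩) id
  · rintro (⟨hu, h0⟩ | ⟨y, hy, hu⟩)
    · exact ⟨h0, avoid_of_infix hu (List.dropLast_prefix u).isInfix⟩
    · exact ⟨ne_nil_of_mem_hit (hne y hy) hu, hu.2⟩

theorem disjoint_avoid_iUnion_hit : Disjoint (avoid P) (⋃ y ∈ P, hit P y) := by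
  simp only [Set.disjoint_iUnion_right]
  exact fun y hy => disjoint_avoid_hit hy

theorem wordMeasure_avoid_diff_add (hne : ∀ y ∈ P, y ≠ []) :
    wordMeasure (avoid P \ {[]}) + wordMeasure (⋃ y ∈ P, hit P y) = wordMeasure (avoid P) := by
  rw [← measure_union (disjoint_avoid_iUnion_hit.mono_left Set.sdiff_subset) .of_discrete,
    ← setOf_dropLast_mem_avoid hne, wordMeasure_dropLast_mem]

theorem wordMeasure_hit_length_lt_le_one (hne : ∀ y ∈ P, y ≠ []) (n : ℕ) :
    wordMeasure ((⋃ y ∈ P, hit P y) ∩ {u | u.length < n}) ≤ 1 := by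
  have hset : {u | u ≠ [] ∧ u.dropLast ∈ avoid P ∩ {u | u.length < n}} ⊇
      (avoid P \ {[]}) ∩ {u | u.length < n} ∪ (⋃ y ∈ P, hit P y) ∩ {u | u.length < n} := by
    rw [← Set.union_inter_distrib_right, ← setOf_dropLast_mem_avoid hne]
    rintro u ⟨⟨h0, hu⟩, hn⟩
    exact ⟨h0, hu, ((List.dropLast_prefix u).length_le.trans_lt hn)⟩
  have h := (measure_mono hset).trans_eq (wordMeasure_dropLast_mem _)
  rw [measure_union ((disjoint_avoid_iUnion_hit.mono_left Set.sdiff_subset).mono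
    Set.inter_subset_left Set.inter_subset_left) .of_discrete] at h
  have hsub : avoid P ∩ {u | u.length < n} ⊆ (avoid P \ {[]}) ∩ {u | u.length < n} ∪ {[]} := by
    rintro u ⟨hu, hn⟩
    by_cases h0 : u = []
    · exact .inr h0
    · exact .inl ⟨⟨hu, h0⟩, hn⟩
  have h' := h.trans ((measure_mono hsub).trans (measure_union_le _ _))
  rw [wordMeasure_singleton_nil] at h'
  exact (ENNReal.add_le_add_iff_left (measure_ne_top_of_subset Set.inter_subset_right
    (wordMeasure_length_lt_ne_top n))).1 h'

theorem wordMeasure_iUnion_hit_le_one (hne : ∀ y ∈ P, y ≠ []) :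
    wordMeasure (⋃ y ∈ P, hit P y) ≤ 1 := by
  have hU : (⋃ y ∈ P, hit P y) = ⋃ n : ℕ, (⋃ y ∈ P, hit P y) ∩ {u | u.length < n} := by
    have huniv : ⋃ n : ℕ, {u : List Bool | u.length < n} = Set.univ :=
      Set.iUnion_eq_univ_iff.2 fun u => ⟨u.length + 1, Nat.lt_succ_self _⟩
    rw [← Set.inter_iUnion, huniv, Set.inter_univ]
  rw [hU, Monotone.measure_iUnion]
  · exact iSup_le fun n => wordMeasure_hit_length_lt_le_one hne n
  · exact fun m n hmn => Set.inter_subset_inter_right _ fun u (hu : u.length < m) => hu.trans_le hmn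

theorem wordMeasure_hit_ne_top (hne : ∀ y ∈ P, y ≠ []) {y : List Bool} (hy : y ∈ P) :
    wordMeasure (hit P y) ≠ ∞ :=
  ((measure_mono (Set.subset_biUnion_of_mem (u := fun y => hit P y) hy)).trans_lt
    ((wordMeasure_iUnion_hit_le_one hne).trans_lt ENNReal.one_lt_top)).ne

/-- An avoiding word followed by the pattern `z` splits at its first hit. -/
theorem image_append_avoid (hP : ∀ y ∈ P, ∀ z ∈ P, y <:+: z → y = z)
    {z : List Bool} (hz : z ∈ P) :
    (· ++ z) '' avoid P = ⋃ q ∈ (Finset.Icc 1 z.length ×ˢ P).filter (fun q => z.take q.1 <:+ q.2),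
      (· ++ z.drop q.1) '' hit P q.2 := by
  ext u
  simp only [Set.mem_image, Set.mem_iUnion, Finset.mem_filter, Finset.mem_product,
    Finset.mem_Icc, exists_prop, Prod.exists]
  constructor
  · rintro ⟨x, hx, rfl⟩
    classical
    have hex : ∃ k, x ++ z.take k ∉ avoid P :=
      ⟨z.length, fun h => h z hz (by simpa using (List.suffix_append x z).isInfix)⟩
    have hk := Nat.find_spec hex
    have hmin := fun j => Nat.find_min (m := j) hex
    have hle : Nat.find hex ≤ z.length := Nat.find_min' hex
      fun h => h z hz (by simpa using (List.suffix_append x z).isInfix)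
    generalize Nat.find hex = k at hk hmin hle
    obtain _ | k := k
    · simp [hx] at hk
    have hlt : k < z.length := hle
    have hd : (x ++ z.take (k + 1)).dropLast = x ++ z.take k := by
      rw [List.take_add_one, List.getElem?_eq_getElem hlt, Option.toList_some, ← List.append_assoc,
        List.dropLast_concat]
    have hdA : (x ++ z.take (k + 1)).dropLast ∈ avoid P := by
      rw [hd]; exact not_not.1 (hmin k k.lt_succ_self)
    obtain ⟨y, hy, hyu⟩ := (mem_avoid_or_mem_hit hdA).resolve_left hk
    refine ⟨k + 1, y, ⟨⟨⟨by omega, hle⟩, hy⟩, ?_⟩, _, hyu, by simp⟩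
    rcases List.suffix_or_suffix_of_suffix hyu.1 (List.suffix_append x (z.take (k + 1))) with h | h
    · obtain rfl := hP y hy z hz (h.isInfix.trans (List.take_prefix _ _).isInfix)
      rw [← h.eq_of_length_le (List.length_take_le' _ _)]
    · exact h
  · rintro ⟨k, y, ⟨⟨⟨hk, hle⟩, hy⟩, hs⟩, u, hu, rfl⟩
    obtain ⟨x, rfl⟩ := hs.trans hu.1
    refine ⟨x, avoid_of_infix hu.2 ?_, by simp⟩
    have ht : z.take k ≠ [] := by
      rw [← List.length_pos_iff_ne_nil, List.length_take]; omega
    rw [List.dropLast_append_of_ne_nil ht]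
    exact (List.prefix_append _ _).isInfix

theorem wordMeasure_avoid_mul (hP : ∀ y ∈ P, ∀ z ∈ P, y <:+: z → y = z)
    {z : List Bool} (hz : z ∈ P) :
    wordMeasure (avoid P) * 2⁻¹ ^ z.length = ∑ y ∈ P, ∑ k ∈ Finset.Icc 1 z.length,
      if z.take k <:+ y then wordMeasure (hit P y) * 2⁻¹ ^ (z.length - k) else 0 := by
  rw [← wordMeasure_image_append, image_append_avoid hP hz, measure_biUnion_finset _
    fun _ _ => .of_discrete, Finset.sum_filter, Finset.sum_product_right]
  · simp only [wordMeasure_image_append, List.length_drop]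
  · intro q hq q' hq' hqq
    simp only [Finset.coe_filter, Finset.mem_product, Finset.mem_Icc, Set.mem_ofPred_eq] at hq hq'
    rw [Function.onFun, Set.disjoint_left]
    rintro _ ⟨u, hu, rfl⟩ ⟨u', hu', he⟩
    obtain rfl := eq_of_prefix_of_mem_hit hq.1.2 hq'.1.2 hu hu' (List.prefix_append _ _)
      ⟨_, he⟩
    refine hqq (Prod.ext ?_ (eq_of_mem_hit hP hq.1.2 hq'.1.2 hu hu'))
    have := congrArg List.length (List.append_cancel_left (he : u ++ _ = u ++ _))
    simp only [List.length_drop] at this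
    omega

theorem wordMeasure_avoid_ne_top (hne : ∀ y ∈ P, y ≠ [])
    (hP : ∀ y ∈ P, ∀ z ∈ P, y <:+: z → y = z) (hPn : P.Nonempty) :
    wordMeasure (avoid P) ≠ ∞ := by
  obtain ⟨z, hz⟩ := hPn
  intro h
  have := wordMeasure_avoid_mul hP hz
  rw [h, ENNReal.top_mul (by simp)] at this
  refine ENNReal.sum_ne_top.2 (fun y hy => ENNReal.sum_ne_top.2 fun k _ => ?_) this.symm
  have := wordMeasure_hit_ne_top hne hy
  split_ifs <;> finiteness

/-- Some pattern of `P` almost surely occurs. -/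
theorem sum_wordMeasure_hit (hne : ∀ y ∈ P, y ≠ [])
    (hP : ∀ y ∈ P, ∀ z ∈ P, y <:+: z → y = z) (hPn : P.Nonempty) :
    ∑ y ∈ P, wordMeasure (hit P y) = 1 := by
  have h := wordMeasure_avoid_diff_add hne
  have hnil : ({[]} : Set (List Bool)) ⊆ avoid P := by simpa using nil_mem_avoid hne
  rw [← measure_sdiff_add_inter (avoid P) (.of_discrete : MeasurableSet {[]}),
    Set.inter_eq_right.2 hnil, wordMeasure_singleton_nil, ENNReal.add_right_inj
      (measure_ne_top_of_subset Set.sdiff_subset (wordMeasure_avoid_ne_top hne hP hPn))] at h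
  rwa [measure_biUnion_finset _ fun _ _ => .of_discrete] at h
  exact fun y hy y' hy' hyy => Set.disjoint_left.2 fun u hu hu' =>
    hyy (eq_of_mem_hit hP hy hy' hu hu')

end Patterns

theorem wProb_half (u : List Bool) : wProb (1 / 2) u = (1 / 2) ^ u.length := by
  rw [wProb, ← List.count_true_add_count_false u, pow_add]
  norm_num

/-- Conway's linear relation between the win probabilities of the patterns. -/
theorem toReal_wordMeasure_avoid {P : Finset (List Bool)} (hne : ∀ y ∈ P, y ≠ [])
    (hP : ∀ y ∈ P, ∀ z ∈ P, y <:+: z → y = z) {z : List Bool} (hz : z ∈ P) :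
    (wordMeasure (avoid P)).toReal =
      ∑ y ∈ P, (wordMeasure (hit P y)).toReal * corr y z (1 / 2) := by
  have h := congrArg ENNReal.toReal (wordMeasure_avoid_mul hP hz)
  have hfin : ∀ y ∈ P, ∀ k ∈ Finset.Icc 1 z.length, (if z.take k <:+ y then
      wordMeasure (hit P y) * 2⁻¹ ^ (z.length - k) else 0) ≠ ∞ := by
    intro y hy k _
    have := wordMeasure_hit_ne_top hne hy
    split_ifs <;> finiteness
  rw [ENNReal.toReal_sum fun y hy => ENNReal.sum_ne_top.2 (hfin y hy), ENNReal.toReal_mul,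
    ← eq_div_iff (by simp), Finset.sum_div] at h
  rw [h]
  refine Finset.sum_congr rfl fun y hy => ?_
  rw [ENNReal.toReal_sum (hfin y hy), corr, Finset.sum_div, Finset.mul_sum]
  refine Finset.sum_congr rfl fun k hk => ?_
  obtain ⟨-, hk⟩ := Finset.mem_Icc.1 hk
  split_ifs
  · rw [wProb_half, List.length_take, min_eq_left hk]
    obtain ⟨j, hj⟩ := Nat.exists_eq_add_of_le hk
    simp [hj, pow_add]
    field_simp
  · simp

theorem occCount_eq_one_iff {x v : List Bool} (hv : v ≠ []) :
    occCount v (x ++ v) = 1 ↔ ¬ v <:+: (x ++ v).dropLast := by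
  have hcard : occCount v (x ++ v) =
      ((Finset.range ((x ++ v).length + 1)).filter fun i => v <+: (x ++ v).drop i).card := by
    rw [occCount, List.countP_eq_length_filter]
    rfl
  have hd := List.dropLast_append_of_ne_nil (l' := x) hv
  rw [hcard, Finset.card_eq_one]
  constructor
  · rintro ⟨a, ha⟩ ⟨s, t, hst⟩
    have hx : x.length ∈ ({a} : Finset ℕ) := by
      rw [← ha]; simp
    have hst' : x ++ v = s ++ (v ++ (t ++ [v.getLast hv])) := by
      calc
        x ++ v = x ++ v.dropLast ++ [v.getLast hv] := by
          rw [List.append_assoc, List.dropLast_append_getLast]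
        _ = s ++ (v ++ (t ++ [v.getLast hv])) := by rw [← hd, ← hst]; simp
    have hs : s.length ∈ ({a} : Finset ℕ) := by
      rw [← ha, hst']; simp
    have := congrArg List.length hst'
    simp only [Finset.mem_singleton, List.length_append, List.length_singleton] at hx hs this
    omega
  · intro h
    refine ⟨x.length, Finset.eq_singleton_iff_unique_mem.2 ⟨by simp, fun i hi => ?_⟩⟩
    obtain ⟨-, t, ht⟩ := Finset.mem_filter.1 hi
    by_contra hix
    have hl := congrArg List.length ht
    simp only [List.length_append, List.length_drop] at hl
    have hpos := List.length_pos_iff_ne_nil.2 hv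
    have ht0 : t ≠ [] := by rintro rfl; simp at hl; omega
    refine h ⟨(x ++ v).take i, t.dropLast, ?_⟩
    rw [List.append_assoc, ← List.dropLast_append_of_ne_nil ht0,
      ← List.dropLast_append_of_ne_nil (by simp [ht0]), ht, List.take_append_drop]

theorem omegaWin_eq_hit {v w : List Bool} (hv : v ≠ []) (hvw : ¬ v <:+: w) (hwv : ¬ w <:+: v) :
    OmegaWin v w = hit {v, w} v := by
  ext u
  simp only [OmegaWin, hit, avoid, Set.mem_ofPred_eq, Finset.forall_mem_insert,
    Finset.mem_singleton, forall_eq]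
  refine and_congr_right ?_
  rintro ⟨x, rfl⟩
  rw [occCount_eq_one_iff hv]
  refine and_congr_right fun _ => not_congr ⟨fun h => ?_, fun h =>
    h.trans (List.dropLast_prefix _).isInfix⟩
  rcases List.infix_concat_iff.1 ((List.dropLast_append_getLast
    (List.append_ne_nil_of_right_ne_nil x hv)).symm ▸ h) with h' | h'
  · rw [List.dropLast_append_getLast] at h'
    rcases List.suffix_or_suffix_of_suffix h' (List.suffix_append x v) with h'' | h''
    · exact absurd h''.isInfix hwv
    · exact absurd h''.isInfix hvw
  · exact h'

theorem win_half {v w : List Bool} (hv : v ≠ []) (hvw : ¬ v <:+: w) (hwv : ¬ w <:+: v) :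
    Win v w (1 / 2) = (wordMeasure (hit {v, w} v)).toReal := by
  rw [← omegaWin_eq_hit hv hvw hwv, wordMeasure_apply, ENNReal.tsum_toReal_eq (by finiteness), Win]
  simp only [wProb_half]
  simp

/-- Conway's formula for the odds, at `p = 1 / 2`. -/
theorem win_half_mul {v w : List Bool} (hv : v ≠ []) (hw : w ≠ []) (hvw : ¬ v <:+: w)
    (hwv : ¬ w <:+: v) :
    Win v w (1 / 2) * (corr v v (1 / 2) - corr v w (1 / 2)) =
      (1 - Win v w (1 / 2)) * (corr w w (1 / 2) - corr w v (1 / 2)) := by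
  have hne : ∀ y ∈ ({v, w} : Finset (List Bool)), y ≠ [] := by simp [hv, hw]
  have hP : ∀ y ∈ ({v, w} : Finset (List Bool)), ∀ z ∈ ({v, w} : Finset (List Bool)),
      y <:+: z → y = z := by simp [hvw, hwv]
  have hvw' : v ≠ w := by rintro rfl; exact hvw List.infix_rfl
  have h1 := congrArg ENNReal.toReal (sum_wordMeasure_hit hne hP (by simp))
  have h2 := toReal_wordMeasure_avoid hne hP (z := v) (by simp)
  have h3 := toReal_wordMeasure_avoid hne hP (z := w) (by simp)
  rw [ENNReal.toReal_sum fun y hy => wordMeasure_hit_ne_top hne hy, Finset.sum_pair hvw',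
    ENNReal.toReal_one] at h1
  rw [Finset.sum_pair hvw'] at h2 h3
  rw [win_half hv hvw hwv]
  linear_combination h3 - h2 + (corr w w (1 / 2) - corr w v (1 / 2)) * h1

section Words

variable {m : ℕ}

theorem getElem?_wpow (m j : ℕ) :
    (wpow [true, false] m)[j]? = if j < 2 * m then some (decide (j % 2 = 0)) else none := by
  induction m generalizing j with
  | zero => simp [wpow]
  | succ m ih =>
    have : wpow [true, false] (m + 1) = true :: false :: wpow [true, false] m := by
      simp [wpow, List.replicate_succ]
    rw [this]
    match j with
    | 0 => simp
    | 1 => simp [mul_add]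
    | j + 2 => simp [ih, mul_add, Nat.add_mod_right]

theorem length_wpow (m : ℕ) : (wpow [true, false] m).length = 2 * m := by
  simp [wpow, mul_comm]

/-- The word `11(10)^m`. -/
def patV (m : ℕ) : List Bool := [true, true] ++ wpow [true, false] m

/-- The word `(10)^m 1`. -/
def patW (m : ℕ) : List Bool := wpow [true, false] m ++ [true]

theorem length_patV (m : ℕ) : (patV m).length = 2 * m + 2 := by
  simp [patV, length_wpow]

theorem length_patW (m : ℕ) : (patW m).length = 2 * m + 1 := by
  simp [patW, length_wpow]

theorem getElem?_patV {j : ℕ} (hj : j < 2 * m + 2) :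
    (patV m)[j]? = some (decide (j < 2 ∨ j % 2 = 0)) := by
  match j with
  | 0 => simp [patV]
  | 1 => simp [patV]
  | j + 2 =>
    have : j < 2 * m := by omega
    simp [patV, getElem?_wpow, this]

theorem getElem?_patW {j : ℕ} (hj : j < 2 * m + 1) :
    (patW m)[j]? = some (decide (j % 2 = 0)) := by
  rw [patW, List.getElem?_append, length_wpow, getElem?_wpow]
  split_ifs with h
  · rfl
  · obtain rfl : j = 2 * m := by omega
    simp

theorem take_suffix_iff {y z : List Bool} {i : ℕ} (hi : i ≤ z.length) :
    z.take i <:+ y ↔ i ≤ y.length ∧ ∀ j < i, z[j]? = y[y.length - i + j]? := by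
  rw [List.suffix_iff_eq_drop, List.length_take, min_eq_left hi]
  constructor
  · intro h
    have hl := congrArg List.length h
    rw [List.length_take, List.length_drop] at hl
    refine ⟨by omega, fun j hj => ?_⟩
    have := congrArg (fun l : List Bool => l[j]?) h
    simpa [List.getElem?_take, hj] using this
  · rintro ⟨hiy, h⟩
    refine List.ext_getElem? fun j => ?_
    rw [List.getElem?_take, List.getElem?_drop]
    split_ifs with hj
    · exact h j hj
    · rw [List.getElem?_eq_none (by omega)]

theorem corr_half (y z : List Bool) :
    corr y z (1 / 2) = ∑ i ∈ Finset.Icc 1 z.length, if z.take i <:+ y then 2 ^ i else 0 := by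
  refine Finset.sum_congr rfl fun i hi => ?_
  rw [wProb_half, List.length_take, min_eq_left (Finset.mem_Icc.1 hi).2]
  simp

theorem take_patV_suffix_patV (hm : 1 ≤ m) {i : ℕ} (hi : i ∈ Finset.Icc 1 (2 * m + 2)) :
    (patV m).take i <:+ patV m ↔ i = 2 * m + 2 := by
  obtain ⟨h1, h2⟩ := Finset.mem_Icc.1 hi
  rw [take_suffix_iff (by rwa [length_patV]), length_patV]
  constructor
  · rintro ⟨-, h⟩
    by_contra hne
    have hlast := h (i - 1) (by omega)
    rw [getElem?_patV (by omega), getElem?_patV (by omega), Option.some_inj,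
      decide_eq_decide] at hlast
    have hone := h 1 (by omega)
    rw [getElem?_patV (by omega), getElem?_patV (by omega), Option.some_inj,
      decide_eq_decide] at hone
    omega
  · rintro rfl
    simp

theorem take_patW_suffix_patW {i : ℕ} (hi : i ∈ Finset.Icc 1 (2 * m + 1)) :
    (patW m).take i <:+ patW m ↔ i % 2 = 1 := by
  obtain ⟨h1, h2⟩ := Finset.mem_Icc.1 hi
  rw [take_suffix_iff (by rwa [length_patW]), length_patW]
  constructor
  · rintro ⟨-, h⟩
    have h0 := h 0 (by omega)
    rw [getElem?_patW (by omega), getElem?_patW (by omega), Option.some_inj,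
      decide_eq_decide] at h0
    omega
  · intro h
    refine ⟨h2, fun j hj => ?_⟩
    rw [getElem?_patW (by omega), getElem?_patW (by omega), Option.some_inj, decide_eq_decide]
    omega

theorem take_patW_suffix_patV (hm : 1 ≤ m) {i : ℕ} (hi : i ∈ Finset.Icc 1 (2 * m + 1)) :
    (patW m).take i <:+ patV m ↔ i % 2 = 0 := by
  obtain ⟨h1, h2⟩ := Finset.mem_Icc.1 hi
  rw [take_suffix_iff (by rwa [length_patW]), length_patV]
  constructor
  · rintro ⟨-, h⟩
    have hlast := h (i - 1) (by omega)
    rw [getElem?_patW (by omega), getElem?_patV (by omega), Option.some_inj,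
      decide_eq_decide] at hlast
    omega
  · intro h
    refine ⟨by omega, fun j hj => ?_⟩
    rw [getElem?_patW (by omega), getElem?_patV (by omega), Option.some_inj, decide_eq_decide]
    omega

theorem take_patV_suffix_patW {i : ℕ} (hi : i ∈ Finset.Icc 1 (2 * m + 2)) :
    (patV m).take i <:+ patW m ↔ i = 1 := by
  obtain ⟨h1, h2⟩ := Finset.mem_Icc.1 hi
  rw [take_suffix_iff (by rwa [length_patV]), length_patW]
  constructor
  · rintro ⟨hle, h⟩
    by_contra hne
    have h0 := h 0 (by omega)
    rw [getElem?_patV (by omega), getElem?_patW (by omega), Option.some_inj,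
      decide_eq_decide] at h0
    have hone := h 1 (by omega)
    rw [getElem?_patV (by omega), getElem?_patW (by omega), Option.some_inj,
      decide_eq_decide] at hone
    omega
  · rintro rfl
    refine ⟨by omega, fun j hj => ?_⟩
    rw [getElem?_patV (by omega), getElem?_patW (by omega), Option.some_inj, decide_eq_decide]
    omega

theorem not_patV_infix_patW (m : ℕ) : ¬ patV m <:+: patW m := fun h => by
  have := h.length_le
  rw [length_patV, length_patW] at this
  omega

theorem not_patW_infix_patV (hm : 1 ≤ m) : ¬ patW m <:+: patV m := by
  rintro ⟨s, t, h⟩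
  have hl := congrArg List.length h
  simp only [List.length_append, length_patV, length_patW] at hl
  have hget : ∀ j < 2 * m + 1, (patW m)[j]? = (patV m)[s.length + j]? := by
    intro j hj
    rw [← h, List.append_assoc, List.getElem?_append_right (by omega),
      List.getElem?_append_left (by rw [length_patW]; omega), Nat.add_sub_cancel_left]
  have hone := hget 1 (by omega)
  rw [getElem?_patW (by omega), getElem?_patV (by omega), Option.some_inj,
    decide_eq_decide] at hone
  have hlast := hget (2 * m) (by omega)
  rw [getElem?_patW (by omega), getElem?_patV (by omega), Option.some_inj,
    decide_eq_decide] at hlast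
  omega

theorem sum_pow_odd (m : ℕ) :
    (∑ i ∈ Finset.Icc 1 (2 * m + 1), if i % 2 = 1 then (2 : ℝ) ^ i else 0) =
      (8 * 4 ^ m - 2) / 3 := by
  induction m with
  | zero => norm_num
  | succ m ih =>
    rw [mul_add, mul_one, Finset.sum_Icc_succ_top (by omega), Finset.sum_Icc_succ_top (by omega),
      ih, if_neg (by omega), if_pos (by omega)]
    rw [show 2 * m + 2 + 1 = 2 * (m + 1) + 1 by ring, pow_succ, pow_mul]
    norm_num
    ring

theorem sum_pow_even (m : ℕ) :
    (∑ i ∈ Finset.Icc 1 (2 * m + 1), if i % 2 = 0 then (2 : ℝ) ^ i else 0) =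
      (4 * 4 ^ m - 4) / 3 := by
  induction m with
  | zero => norm_num
  | succ m ih =>
    rw [mul_add, mul_one, Finset.sum_Icc_succ_top (by omega), Finset.sum_Icc_succ_top (by omega),
      ih, if_pos (by omega), if_neg (by omega)]
    rw [show 2 * m + 1 + 1 = 2 * (m + 1) by ring, pow_mul]
    norm_num
    ring

theorem corr_patV_patV (hm : 1 ≤ m) : corr (patV m) (patV m) (1 / 2) = 4 * 4 ^ m := by
  rw [corr_half, length_patV, Finset.sum_congr rfl fun i hi =>
    if_congr (take_patV_suffix_patV hm hi) rfl rfl, Finset.sum_ite_eq', if_pos (by simp),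
    pow_add, pow_mul]
  norm_num
  ring

theorem corr_patW_patW (m : ℕ) : corr (patW m) (patW m) (1 / 2) = (8 * 4 ^ m - 2) / 3 := by
  rw [corr_half, length_patW, ← sum_pow_odd]
  exact Finset.sum_congr rfl fun i hi => if_congr (take_patW_suffix_patW hi) rfl rfl

theorem corr_patV_patW (hm : 1 ≤ m) : corr (patV m) (patW m) (1 / 2) = (4 * 4 ^ m - 4) / 3 := by
  rw [corr_half, length_patW, ← sum_pow_even]
  exact Finset.sum_congr rfl fun i hi => if_congr (take_patW_suffix_patV hm hi) rfl rfl

theorem corr_patW_patV (m : ℕ) : corr (patW m) (patV m) (1 / 2) = 2 := by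
  rw [corr_half, length_patV, Finset.sum_congr rfl fun i hi =>
    if_congr (take_patV_suffix_patW hi) rfl rfl, Finset.sum_ite_eq', if_pos (by simp), pow_one]

theorem win_patV_patW (hm : 1 ≤ m) :
    Win (patV m) (patW m) (1 / 2) = 1 / 2 - 3 / (8 * 4 ^ m - 2) := by
  have h := win_half_mul (List.ne_nil_of_length_pos (by rw [length_patV]; omega))
    (List.ne_nil_of_length_pos (by rw [length_patW]; omega)) (not_patV_infix_patW m)
    (not_patW_infix_patV hm)
  rw [corr_patV_patV hm, corr_patV_patW hm, corr_patW_patW, corr_patW_patV] at h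
  have h4 : (1 : ℝ) ≤ 4 ^ m := one_le_pow₀ (by norm_num)
  have hpos : (8 * 4 ^ m - 2 : ℝ) ≠ 0 := by linarith
  field_simp
  linear_combination 3 * h

end Words

/-- The pair `v = 11(10)^m`, `w = (10)^m 1` has win probability `1/2 - O(4^{-m})`,
strictly below `1/2`. -/
theorem stmt4 :
    ∃ C : ℝ, 0 < C ∧ ∀ m : ℕ, 1 ≤ m →
      1/2 - C / 4 ^ m ≤
          Win ([true, true] ++ wpow [true, false] m) (wpow [true, false] m ++ [true]) (1/2) ∧
      Win ([true, true] ++ wpow [true, false] m) (wpow [true, false] m ++ [true]) (1/2)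
          < 1/2 := by
  refine ⟨1, one_pos, fun m hm => ?_⟩
  have h4 : (1 : ℝ) ≤ 4 ^ m := one_le_pow₀ (by norm_num)
  have hpos : (0 : ℝ) < 8 * 4 ^ m - 2 := by linarith
  change _ ≤ Win (patV m) (patW m) _ ∧ Win (patV m) (patW m) _ < _
  rw [win_patV_patW hm]
  refine ⟨sub_le_sub_left ?_ _, sub_lt_self _ (by positivity)⟩
  rw [div_le_div_iff₀ hpos (by positivity)]
  linarith
end

section
/- For each fixed integer k ≥ 0, the pair v = 0^{k+1} 1^{n−1} (k+1 zeros followed by n−1 ones) and w = 1^n (n ones) satisfies lim_{n→∞} Win(0^{k+1} 1^{n−1}, 1^n; 1/2) = 2/(1 + 2^k). -/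
open scoped BigOperators

open scoped ENNReal

theorem append_false_replicate_inj {p q : List Bool} {i m : ℕ}
    (h : p ++ [false] ++ List.replicate i true = q ++ [false] ++ List.replicate m true) :
    p = q ∧ i = m := by
  induction i generalizing m with
  | zero => cases m with
    | zero => simpa using h
    | succ m =>
      rw [List.replicate_succ', ← List.append_assoc, List.replicate_zero, List.append_nil] at h
      simpa using (List.append_inj' h rfl).2
  | succ i ih => cases m with
    | zero =>
      rw [List.replicate_succ', ← List.append_assoc, List.replicate_zero, List.append_nil] at h
      simpa using (List.append_inj' h rfl).2
    | succ m =>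
      rw [List.replicate_succ', List.replicate_succ', ← List.append_assoc, ← List.append_assoc] at h
      obtain ⟨h1, h2⟩ := ih (List.append_inj' h rfl).1
      exact ⟨h1, by omega⟩

theorem occCount_eq_one_iff_s6 {v u : List Bool} :
    occCount v u = 1 ↔ ∃ i ≤ u.length, ∀ j ≤ u.length, v <+: u.drop j ↔ j = i := by
  have : occCount v u = ((Finset.range (u.length+1)).filter (fun i => v <+: u.drop i)).card := by
    unfold occCount
    rw [List.countP_eq_length_filter]
    rfl
  rw [this, Finset.card_eq_one]
  simp only [Finset.ext_iff, Finset.mem_filter, Finset.mem_range, Finset.mem_singleton]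
  constructor
  · rintro ⟨i, hi⟩
    exact ⟨i, by have := (hi i).2 rfl; omega, fun j hj => by have := hi j; grind⟩
  · rintro ⟨i, hi, h⟩
    refine ⟨i, ?_⟩; grind

/-- Total mass of a set of words when every word `u` has weight `2 ^ (-|u|)`. -/
noncomputable def mass (X : Set (List Bool)) : ℝ≥0∞ := ∑' u : X, (2⁻¹ : ℝ≥0∞) ^ (u : List Bool).length

theorem mass_union {X Y : Set (List Bool)} (h : Disjoint X Y) : mass (X ∪ Y) = mass X + mass Y :=
  Summable.tsum_union_disjoint (f := fun u : List Bool => (2⁻¹ : ℝ≥0∞) ^ u.length) h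
    ENNReal.summable ENNReal.summable

theorem mass_mono {X Y : Set (List Bool)} (h : X ⊆ Y) : mass X ≤ mass Y :=
  ENNReal.tsum_mono_subtype (fun u : List Bool => (2⁻¹ : ℝ≥0∞) ^ u.length) h

theorem mass_image_append (X : Set (List Bool)) (c : List Bool) :
    mass ((· ++ c) '' X) = mass X * 2⁻¹ ^ c.length := by
  unfold mass
  rw [tsum_image (fun u : List Bool => (2⁻¹ : ℝ≥0∞) ^ u.length)
    (fun x _ y _ h => List.append_cancel_right h), ← ENNReal.tsum_mul_right]
  simp [pow_add]

theorem mass_singleton_nil : mass {[]} = 1 := by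
  simp [mass]

theorem mass_ne_top_of_finite {X : Set (List Bool)} (h : X.Finite) : mass X ≠ ∞ := by
  have := h.to_subtype
  have := Fintype.ofFinite X
  unfold mass
  rw [tsum_fintype]
  exact ENNReal.sum_ne_top.2 fun u _ => ENNReal.pow_ne_top (by simp)

/-- Words leaving `N` at their last letter. -/
def exitWords (N : Set (List Bool)) : Set (List Bool) :=
  {u | u ∉ N ∧ ∃ x ∈ N, ∃ a, u = x ++ [a]}

theorem one_add_mass_eq {N : Set (List Bool)} (h0 : [] ∈ N) (hN : ∀ x a, x ++ [a] ∈ N → x ∈ N) :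
    1 + mass N = mass N + mass (exitWords N) := by
  have e : {[]} ∪ (((· ++ [false]) '' N) ∪ ((· ++ [true]) '' N)) = N ∪ exitWords N := by
    ext u
    rcases List.eq_nil_or_concat u with rfl | ⟨x, a, rfl⟩
    · simp [h0]
    · have := hN x a
      cases a <;> simp [exitWords] <;> tauto
  have d1 : Disjoint (((· ++ [false]) '' N)) ((· ++ [true]) '' N) := by
    rw [Set.disjoint_left]
    rintro _ ⟨x, _, rfl⟩ ⟨y, _, h⟩
    simpa using (List.append_inj' h rfl).2
  have d2 : Disjoint {[]} (((· ++ [false]) '' N) ∪ ((· ++ [true]) '' N)) := by simp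
  have d3 : Disjoint N (exitWords N) := by
    rw [Set.disjoint_left]
    exact fun u hu h => h.1 hu
  rw [← mass_union d3, ← e, mass_union d2, mass_union d1, mass_image_append, mass_image_append,
    mass_singleton_nil, ← mul_add]
  simp [ENNReal.inv_two_add_inv_two]

theorem mass_exitWords_le_one {N : Set (List Bool)} (h0 : [] ∈ N)
    (hN : ∀ x a, x ++ [a] ∈ N → x ∈ N) : mass (exitWords N) ≤ 1 := by
  unfold mass
  rw [ENNReal.tsum_eq_iSup_sum]
  refine iSup_le fun s => ?_
  set L := s.sup fun u => (u : List Bool).length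
  set M := N ∩ {u | u.length ≤ L}
  have hM : mass M ≠ ∞ :=
    mass_ne_top_of_finite ((List.finite_length_le Bool L).subset Set.inter_subset_right)
  have key : mass (exitWords M) = 1 := by
    have := one_add_mass_eq (N := M) ⟨h0, by simp⟩
      (fun x a h => ⟨hN x a h.1, by have := h.2; simp at this ⊢; omega⟩)
    rw [add_comm] at this
    exact ((ENNReal.add_right_inj hM).1 this).symm
  rw [← key]
  have hs : ∀ u ∈ s, (u : List Bool) ∈ exitWords M := by
    rintro ⟨u, hu, x, hx, a, rfl⟩ hus
    have hl : (x ++ [a]).length ≤ L := 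
      Finset.le_sup (f := fun u : exitWords N => (u : List Bool).length) hus
    refine ⟨fun h => hu h.1, x, ⟨hx, ?_⟩, a, rfl⟩
    simp at hl ⊢; omega
  calc _ = ∑ u ∈ s.map ⟨Subtype.val, Subtype.val_injective⟩, (2⁻¹ : ℝ≥0∞) ^ u.length := by simp
    _ = mass (s.map ⟨Subtype.val, Subtype.val_injective⟩ : Finset (List Bool)) := by
      unfold mass
      exact (Finset.tsum_subtype _ (fun u : List Bool => (2⁻¹ : ℝ≥0∞) ^ u.length)).symm
    _ ≤ _ := by
      apply mass_mono
      intro u hu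
      simp only [Finset.coe_map, Set.mem_image] at hu
      obtain ⟨u, hu, rfl⟩ := hu
      exact hs u hu

theorem mass_exitWords_eq_one {N : Set (List Bool)} (h0 : [] ∈ N)
    (hN : ∀ x a, x ++ [a] ∈ N → x ∈ N) (h : mass N ≠ ∞) : mass (exitWords N) = 1 := by
  have := one_add_mass_eq h0 hN
  rw [add_comm] at this
  exact ((ENNReal.add_right_inj h).1 this).symm

theorem toReal_mass_OmegaWin (v w : List Bool) : (mass (OmegaWin v w)).toReal = Win v w (1 / 2) := by
  unfold mass Win wProb
  rw [ENNReal.tsum_toReal_eq (fun _ => ENNReal.pow_ne_top (by simp))]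
  refine tsum_congr fun u => ?_
  have h : (1 : ℝ) - 1 / 2 = 1 / 2 := by norm_num
  rw [h, ← pow_add, List.count_true_add_count_false]
  simp

/-- Words containing neither `v` nor `w`. -/
def avoiding (v w : List Bool) : Set (List Bool) := {x | ¬ v <:+: x ∧ ¬ w <:+: x}

theorem mem_avoiding_of_isPrefix {v w x y : List Bool} (h : y ∈ avoiding v w) (hx : x <+: y) :
    x ∈ avoiding v w :=
  ⟨fun h' => h.1 (h'.trans hx.isInfix), fun h' => h.2 (h'.trans hx.isInfix)⟩

theorem infix_or_prefix_drop {v x y : List Bool} (h : v <:+: x ++ y) :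
    v <:+: x ∨ ∃ i, x.length < i + v.length ∧ i + v.length ≤ (x ++ y).length ∧
      v <+: (x ++ y).drop i := by
  obtain ⟨s, t, h⟩ := h
  have hp : v <+: (x ++ y).drop s.length := by simp [← h]
  by_cases hl : s.length + v.length ≤ x.length
  · left
    rw [List.drop_append_of_le_length (by omega)] at hp
    exact (List.prefix_of_prefix_length_le hp (List.prefix_append _ _)
      (by simp; omega)).isInfix.trans (List.drop_suffix _ _).isInfix
  · exact .inr ⟨s.length, by omega, by simp [← h, ← add_assoc], hp⟩

/-- The word `0 ^ (k + 1) 1 ^ m`. -/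
def zerosOnes (k m : ℕ) : List Bool := List.replicate (k + 1) false ++ List.replicate m true

theorem length_zerosOnes (k m : ℕ) : (zerosOnes k m).length = k + 1 + m := by simp [zerosOnes]

theorem getElem?_zerosOnes (k m j : ℕ) :
    (zerosOnes k m)[j]? = if j < k + 1 + m then some (decide (k + 1 ≤ j)) else none := by
  unfold zerosOnes
  grind

theorem zerosOnes_eq (k m : ℕ) : zerosOnes k m =
    List.replicate k false ++ [false] ++ List.replicate m true := by
  simp [zerosOnes, List.replicate_succ']

/-- `0 ^ (k + 1) 1 ^ m` has no self-overlap. -/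
theorem eq_length_of_prefix_drop {k m i : ℕ} (hm : 1 ≤ m) {x : List Bool}
    (hi : x.length < i + (zerosOnes k m).length)
    (hp : zerosOnes k m <+: (x ++ zerosOnes k m).drop i)
    (hi' : i + (zerosOnes k m).length ≤ (x ++ zerosOnes k m).length) : i = x.length := by
  by_contra hne
  rw [List.prefix_iff_getElem?] at hp
  rw [length_zerosOnes] at *
  rw [List.length_append, length_zerosOnes] at hi'
  have key : ∀ j, j < k + 1 + m → (x ++ zerosOnes k m)[i + j]? = some (decide (k + 1 ≤ j)) := by
    intro j hj
    have := hp j (by rwa [length_zerosOnes])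
    rw [List.getElem?_drop, ← List.getElem?_eq_getElem, getElem?_zerosOnes, if_pos hj] at this
    exact this
  have h1 := key (x.length - i) (by omega)
  rw [List.getElem?_append_right (by omega), getElem?_zerosOnes, if_pos (by omega)] at h1
  simp only [Option.some.injEq, decide_eq_decide] at h1
  have h2 := key (k + 1) (by omega)
  rw [List.getElem?_append_right (by omega), getElem?_zerosOnes, if_pos (by omega)] at h2
  simp only [Option.some.injEq, decide_eq_decide] at h2
  omega

/-- `1 ^ (m + 1)` cannot end inside a trailing `0 ^ (k + 1) 1 ^ m`. -/
theorem ones_not_infix_append {k m : ℕ} {x : List Bool}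
    (hx : ¬ List.replicate (m + 1) true <:+: x) :
    ¬ List.replicate (m + 1) true <:+: x ++ zerosOnes k m := by
  intro h
  rcases infix_or_prefix_drop h with h | ⟨i, h1, h2, h⟩
  · exact hx h
  rw [List.prefix_iff_getElem?] at h
  simp only [List.length_append, length_zerosOnes, List.length_replicate] at h1 h2 h
  have h3 := h (max i x.length - i) (by omega)
  rw [List.getElem?_drop, List.getElem?_append_right (by omega), getElem?_zerosOnes] at h3
  rw [if_pos (by omega)] at h3
  simp at h3
  omega

theorem zerosOnes_infix_append {k m : ℕ} (hm : 1 ≤ m) {x y : List Bool}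
    (hx : ¬ zerosOnes k m <:+: x) (hy : y <+: zerosOnes k m) (h : zerosOnes k m <:+: x ++ y) :
    y = zerosOnes k m := by
  rcases infix_or_prefix_drop h with h | ⟨i, h1, h2, h⟩
  · exact absurd h hx
  obtain ⟨t, ht⟩ := hy
  have h3 := eq_length_of_prefix_drop hm h1 (x := x) (by
    refine h.trans ?_
    conv_rhs => rw [← ht]
    rw [← List.append_assoc, List.drop_append (l₁ := x ++ y)]
    exact List.prefix_append _ _) (by
    rw [List.length_append] at h2 ⊢
    have := congrArg List.length ht
    rw [List.length_append] at this
    omega)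
  have h4 : t.length = 0 := by
    have := congrArg List.length ht
    rw [List.length_append] at this h2
    omega
  simp_all

theorem OmegaWin_eq_image {k m : ℕ} (hm : 1 ≤ m) :
    OmegaWin (zerosOnes k m) (List.replicate (m + 1) true) =
      (· ++ zerosOnes k m) '' avoiding (zerosOnes k m) (List.replicate (m + 1) true) := by
  ext u
  constructor
  · rintro ⟨⟨x, rfl⟩, h2, h3⟩
    refine ⟨x, ⟨fun h => ?_, fun h => h3 (h.trans (List.prefix_append _ _).isInfix)⟩, rfl⟩
    obtain ⟨s, t, rfl⟩ := h
    obtain ⟨i, _, hi⟩ := occCount_eq_one_iff_s6.1 h2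
    have e1 := (hi s.length (by simp)).1 (by simp)
    have e2 := (hi (s ++ zerosOnes k m ++ t).length (by simp)).1 (by simp)
    rw [← e1] at e2
    simp [length_zerosOnes] at e2
  · rintro ⟨x, ⟨h1, h2⟩, rfl⟩
    refine ⟨List.suffix_append _ _, ?_, ones_not_infix_append h2⟩
    refine occCount_eq_one_iff_s6.2 ⟨x.length, by simp, fun j hj => ⟨fun h => ?_, ?_⟩⟩
    · have hl := h.length_le
      have hv := length_zerosOnes k m
      rw [List.length_drop] at hl
      beta_reduce at hl hj
      refine eq_length_of_prefix_drop hm ?_ h (by omega)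
      by_contra hc
      rw [List.drop_append_of_le_length (by omega)] at h
      exact h1 ((List.prefix_of_prefix_length_le h (List.prefix_append _ _)
        (by simp; omega)).isInfix.trans (List.drop_suffix _ _).isInfix)
    · rintro rfl
      simp

theorem append_zerosOnes_mem_exitWords {k m : ℕ} (hm : 1 ≤ m) {x : List Bool}
    (hx : x ∈ avoiding (zerosOnes k m) (List.replicate (m + 1) true)) :
    x ++ zerosOnes k m ∈ exitWords (avoiding (zerosOnes k m) (List.replicate (m + 1) true)) := by
  obtain ⟨m, rfl⟩ := Nat.exists_eq_add_of_le' hm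
  have e : zerosOnes k (m + 1) = zerosOnes k m ++ [true] := by
    simp [zerosOnes, List.replicate_succ']
  have hp : x ++ zerosOnes k m <+: x ++ zerosOnes k (m + 1) := by
    rw [e, ← List.append_assoc]; exact List.prefix_append _ _
  refine ⟨fun h => h.1 (List.suffix_append _ _).isInfix, x ++ zerosOnes k m, ⟨fun h => ?_, fun h => ?_⟩,
    true, by rw [e, List.append_assoc]⟩
  · have := zerosOnes_infix_append hm hx.1 (by rw [e]; exact List.prefix_append _ _) h
    simpa [length_zerosOnes] using congrArg List.length this
  · exact ones_not_infix_append hx.2 (h.trans hp.isInfix)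

theorem append_false_mem_avoiding {k m : ℕ} (hm : 1 ≤ m) {x : List Bool}
    (hx : x ∈ avoiding (zerosOnes k m) (List.replicate (m + 1) true)) :
    x ++ [false] ∈ avoiding (zerosOnes k m) (List.replicate (m + 1) true) := by
  obtain ⟨m, rfl⟩ := Nat.exists_eq_add_of_le' hm
  constructor <;> rw [List.infix_concat_iff]
  · rintro (⟨t, h⟩ | h)
    · rw [zerosOnes, List.replicate_succ' (n := m), ← List.append_assoc, ← List.append_assoc] at h
      simpa using (List.append_inj' h rfl).2
    · exact hx.1 h
  · rintro (⟨t, h⟩ | h)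
    · rw [List.replicate_succ' (n := m + 1), ← List.append_assoc] at h
      simpa using (List.append_inj' h rfl).2
    · exact hx.2 h

theorem append_replicate_false_mem_avoiding {k m : ℕ} (hm : 1 ≤ m) {x : List Bool}
    (hx : x ∈ avoiding (zerosOnes k m) (List.replicate (m + 1) true)) (i : ℕ) :
    x ++ List.replicate i false ∈ avoiding (zerosOnes k m) (List.replicate (m + 1) true) := by
  induction i with
  | zero => simpa
  | succ i ih =>
    rw [List.replicate_succ' (n := i), ← List.append_assoc]
    exact append_false_mem_avoiding hm ih

/-- A run of ones following the empty word or a zero has the evident length. -/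
theorem replicate_true_suffix_imp {y : List Bool} (hy : y = [] ∨ ∃ x, y = x ++ [false]) {i j : ℕ}
    (h : List.replicate j true <:+ y ++ List.replicate i true) : j ≤ i := by
  by_contra hc
  obtain ⟨t, h⟩ := h
  rcases hy with rfl | ⟨x, rfl⟩
  · have := congrArg List.length h
    simp at this
    omega
  · obtain ⟨d, rfl⟩ := Nat.exists_eq_add_of_lt (not_le.1 hc)
    rw [show i + d + 1 = d + 1 + i by ring, ← List.replicate_append_replicate,
      ← List.append_assoc, List.replicate_succ', ← List.append_assoc] at h
    simpa using (List.append_inj' (List.append_inj' h rfl).1 rfl).2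

theorem zerosOnes_suffix_imp {y : List Bool} (hy : y = [] ∨ ∃ x, y = x ++ [false]) {k m i : ℕ}
    (h : zerosOnes k m <:+ y ++ List.replicate i true) :
    i = m ∧ ∃ z, y = z ++ List.replicate (k + 1) false := by
  obtain ⟨t, h⟩ := h
  rw [zerosOnes_eq, ← List.append_assoc, ← List.append_assoc] at h
  rcases hy with rfl | ⟨x, rfl⟩
  · have : false ∈ List.replicate i true := by
      rw [← List.nil_append (List.replicate i true), ← h]; simp
    simp at this
  · obtain ⟨h1, h2⟩ := append_false_replicate_inj h
    exact ⟨h2.symm, t, by rw [← h1, List.append_assoc, List.replicate_succ']⟩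

/-- Exit words ending in `1 ^ (m + 1)`, together with the words `z 0 ^ (k + 1) 1 ^ (m + 1)`. -/
theorem exitWords_diff_union {k m : ℕ} (hm : 1 ≤ m) :
    let v := zerosOnes k m
    let w := List.replicate (m + 1) true
    let N := avoiding v w
    exitWords N \ ((· ++ v) '' N) ∪ (· ++ (List.replicate (k + 1) false ++ w)) '' N =
      (· ++ w) '' ({[]} ∪ (· ++ [false]) '' N) := by
  intro v w N
  ext u
  constructor
  · rintro (⟨⟨hu, x, hx, a, rfl⟩, hA⟩ | ⟨z, hz, rfl⟩)
    · have hs : w <:+ x ++ [a] := by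
        by_contra hw
        refine hu ⟨fun h => ?_, fun h => ?_⟩ <;> rw [List.infix_concat_iff] at h
        · rcases h with ⟨y, h⟩ | h
          · refine hA ⟨y, mem_avoiding_of_isPrefix hx ?_, h⟩
            refine List.prefix_of_prefix_length_le (l₃ := x ++ [a]) (h ▸ List.prefix_append _ _)
              (List.prefix_append _ _) ?_
            have := congrArg List.length h
            simp [v, length_zerosOnes] at this
            omega
          · exact hx.1 h
        · exact h.elim hw hx.2
      obtain ⟨y, h⟩ := hs
      have h' : y ++ List.replicate m true = x := by
        simp only [w, List.replicate_succ', ← List.append_assoc] at h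
        exact (List.append_inj' h rfl).1
      refine ⟨y, ?_, h⟩
      rcases List.eq_nil_or_concat y with rfl | ⟨y, b, rfl⟩
      · exact .inl rfl
      · cases b with
        | false =>
          refine .inr ⟨y, mem_avoiding_of_isPrefix hx ?_, by simp⟩
          rw [← h']; simp
        | true =>
          refine absurd ⟨y, [], ?_⟩ hx.2
          rw [← h']; simp [w, List.replicate_succ]
    · refine ⟨z ++ List.replicate (k + 1) false, .inr ⟨z ++ List.replicate k false,
        append_replicate_false_mem_avoiding hm hz k, ?_⟩, ?_⟩ <;> simp [List.replicate_succ']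
  · rintro ⟨y, hy, rfl⟩
    by_cases hC : ∃ z, y = z ++ List.replicate (k + 1) false
    · obtain ⟨z, rfl⟩ := hC
      refine .inr ⟨z, ?_, by simp⟩
      rcases hy with hy | ⟨x, hx, h⟩
      · simp at hy
      · refine mem_avoiding_of_isPrefix hx ?_
        simp only [List.replicate_succ', ← List.append_assoc] at h
        rw [(List.append_inj' h rfl).1]
        exact List.prefix_append _ _
    have hy' : y = [] ∨ ∃ x, y = x ++ [false] :=
      hy.imp id (fun ⟨x, _, h⟩ => ⟨x, h.symm⟩)
    have hyN : y ∈ N := by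
      rcases hy with rfl | ⟨x, hx, rfl⟩
      · constructor <;> simp [v, w, zerosOnes]
      · exact append_false_mem_avoiding hm hx
    have run : ∀ i ≤ m, y ++ List.replicate i true ∈ N := by
      intro i
      induction i with
      | zero => simpa using hyN
      | succ i ih =>
        intro hi
        have ih := ih (by omega)
        have e : y ++ List.replicate (i + 1) true = y ++ List.replicate i true ++ [true] := by
          rw [List.replicate_succ', List.append_assoc]
        constructor <;> rw [e, List.infix_concat_iff, ← e]
        · exact fun h => h.elim (fun h => hC (zerosOnes_suffix_imp hy' h).2) ih.1
        · exact fun h => h.elim (fun h => by have := replicate_true_suffix_imp hy' h; omega) ih.2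
    refine .inl ⟨⟨fun h => h.2 (List.suffix_append _ _).isInfix, _, run m le_rfl, true, ?_⟩, ?_⟩
    · simp [w, List.replicate_succ']
    · rintro ⟨z, _, h⟩
      exact hC (zerosOnes_suffix_imp hy' ⟨z, h⟩).2

theorem Win_zerosOnes {k m : ℕ} (hm : 1 ≤ m) :
    Win (zerosOnes k m) (List.replicate (m + 1) true) (1 / 2) =
      2 * (1 - (1 / 2) ^ (m + 1)) / (1 + 2 ^ k) := by
  set v := zerosOnes k m with hv
  set w := List.replicate (m + 1) true with hw
  set N := avoiding v w with hN
  set A := (· ++ v) '' N with hA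
  set B := exitWords N \ A with hB
  have h0 : [] ∈ N := by constructor <;> simp [v, w, zerosOnes]
  have hcl : ∀ x a, x ++ [a] ∈ N → x ∈ N := fun x a h =>
    mem_avoiding_of_isPrefix h (List.prefix_append _ _)
  have hAsub : A ⊆ exitWords N := by
    rintro _ ⟨x, hx, rfl⟩
    exact append_zerosOnes_mem_exitWords hm hx
  have massA : mass A = mass N * 2⁻¹ ^ (k + 1 + m) := by
    rw [hA, mass_image_append, hv, length_zerosOnes]
  have hNtop : mass N ≠ ∞ := by
    intro h
    have := (mass_mono hAsub).trans (mass_exitWords_le_one h0 hcl)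
    rw [massA, h, ENNReal.top_mul (by simp)] at this
    simp at this
  have hAB : mass A + mass B = 1 := by
    rw [← mass_union Set.disjoint_sdiff_right, Set.union_sdiff_cancel hAsub,
      mass_exitWords_eq_one h0 hcl hNtop]
  have hBC : mass B + mass N * 2⁻¹ ^ (k + 1 + (m + 1)) = (1 + mass N * 2⁻¹) * 2⁻¹ ^ (m + 1) := by
    have hd : Disjoint B ((· ++ (List.replicate (k + 1) false ++ w)) '' N) := by
      rw [Set.disjoint_left]
      rintro _ ⟨⟨_, x, hx, a, h⟩, _⟩ ⟨z, _, rfl⟩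
      refine hx.1 ⟨z, [], ?_⟩
      simp only [w, List.replicate_succ' (n := m), ← List.append_assoc] at h
      rw [← (List.append_inj' h rfl).1]
      simp [v, zerosOnes]
    have h1 := congrArg mass (exitWords_diff_union (k := k) hm)
    have hd' : Disjoint {[]} ((· ++ [false]) '' N) := by simp
    rw [mass_union hd, mass_image_append, mass_image_append, mass_union hd', mass_image_append,
      mass_singleton_nil] at h1
    simpa [w] using h1
  have hAtop : mass A ≠ ∞ := fun h => by simp [h] at hAB
  have hBtop : mass B ≠ ∞ := fun h => by simp [h] at hAB
  rw [← toReal_mass_OmegaWin, OmegaWin_eq_image hm]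
  have rA := congrArg ENNReal.toReal massA
  have rAB := congrArg ENNReal.toReal hAB
  have rBC := congrArg ENNReal.toReal hBC
  rw [ENNReal.toReal_add hAtop hBtop] at rAB
  rw [ENNReal.toReal_add hBtop (by finiteness), ENNReal.toReal_mul, ENNReal.toReal_mul,
    ENNReal.toReal_add (by simp) (by finiteness), ENNReal.toReal_mul] at rBC
  rw [ENNReal.toReal_mul] at rA
  simp only [ENNReal.toReal_pow, ENNReal.toReal_inv, ENNReal.toReal_ofNat, ENNReal.toReal_one]
    at rA rAB rBC
  change (mass A).toReal = _
  set a := (mass A).toReal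
  set b := (mass B).toReal
  set M := (mass N).toReal
  rw [eq_div_iff (by positivity)]
  have hM : M * (1 / 2) ^ (m + 1) = a * 2 ^ k := by
    rw [rA, show k + 1 + m = m + 1 + k by ring, pow_add _ (m + 1), mul_assoc, mul_assoc, ← mul_pow]
    norm_num
  have hM' : M * (2⁻¹) ^ (k + 1 + (m + 1)) = a / 2 := by
    rw [rA]; ring
  rw [hM'] at rBC
  norm_num at *
  linear_combination 2 * rAB - 2 * rBC - hM

/-- The bound `2/(1+2^k)` is asymptotically attained by `(0^{k+1} 1^{n-1}, 1^n)`. -/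
theorem stmt6 (k : ℕ) :
    Filter.Tendsto
      (fun n : ℕ =>
        Win (List.replicate (k+1) false ++ List.replicate (n-1) true)
          (List.replicate n true) (1/2))
      Filter.atTop (nhds (2 / (1 + 2 ^ k))) := by
  have h : Filter.Tendsto (fun n : ℕ => 2 * (1 - (1 / 2 : ℝ) ^ n) / (1 + 2 ^ k)) Filter.atTop
      (nhds (2 * (1 - 0) / (1 + 2 ^ k))) :=
    ((tendsto_const_nhds.sub (tendsto_pow_atTop_nhds_zero_of_lt_one (by norm_num)
      (by norm_num))).const_mul 2).div_const _
  rw [sub_zero, mul_one] at h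
  refine h.congr' ?_
  filter_upwards [Filter.eventually_ge_atTop 2] with n hn
  obtain ⟨m, rfl⟩ := Nat.exists_eq_add_of_le' (show 1 ≤ n by omega)
  exact (Win_zerosOnes (by omega)).symm
end
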